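/- Let K be an algebraically closed field of characteristic p > 2. The algebra A_s(m|n) of supersymmetric polynomials is generated as a K-algebra by the polynomials c_r(x|y) for r ≥ 0, σ_i(x_1,…,x_m)^p for 1 ≤ i ≤ m, σ_j(y_1,…,y_n)^p for 1 ≤ j ≤ n, and u_k(m|n) = σ_m(x_1,…,x_m)^k σ_n(y_1,…,y_n)^{p−k} for 0 < k < p; that is, A_s(m|n) = A_ns(m|n). -/

import Mathlib

open MvPolynomial

noncomputable section

/-- The substitution `x_m = y_n = T`, landing in polynomials in `T` over the original ring
(the image only involves the remaining variables). -/
def psiSub (K : Type*) [CommSemiring K] (m n : ℕ) :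
    MvPolynomial (Fin m ⊕ Fin n) K →ₐ[K] Polynomial (MvPolynomial (Fin m ⊕ Fin n) K) :=
  MvPolynomial.aeval (Sum.elim
    (fun i : Fin m => if (i : ℕ) = m - 1 then Polynomial.X
      else Polynomial.C (MvPolynomial.X (Sum.inl i)))
    (fun j : Fin n => if (j : ℕ) = n - 1 then Polynomial.X
      else Polynomial.C (MvPolynomial.X (Sum.inr j))))

/-- `f` is supersymmetric: symmetric in the `x` and `y` variables separately, and
`(d/dT) f|_{x_m = y_n = T} = 0`. -/
def IsSupersymmetric (K : Type*) [CommSemiring K] (m n : ℕ)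
    (f : MvPolynomial (Fin m ⊕ Fin n) K) : Prop :=
  (∀ σ : Equiv.Perm (Fin m), MvPolynomial.rename (Sum.map σ id) f = f) ∧
  (∀ τ : Equiv.Perm (Fin n), MvPolynomial.rename (Sum.map id τ) f = f) ∧
  Polynomial.derivative (psiSub K m n f) = 0

/-- `c_r(x|y) = Σ_{i=0}^{min(r,m)} (−1)^{r−i} σ_i(x) h_{r−i}(y)`. -/
def cpoly (K : Type*) [CommRing K] (m n r : ℕ) : MvPolynomial (Fin m ⊕ Fin n) K :=
  ∑ i ∈ Finset.range (min r m + 1),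
    (-1 : MvPolynomial (Fin m ⊕ Fin n) K) ^ (r - i) *
      (MvPolynomial.rename Sum.inl (MvPolynomial.esymm (Fin m) K i)) *
      (MvPolynomial.rename Sum.inr (MvPolynomial.hsymm (Fin n) K (r - i)))

/-- σ_i(x_1,…,x_m), viewed in K[x_1,…,x_m,y_1,…,y_n]. -/
def sigmaX (K : Type*) [CommSemiring K] (m n i : ℕ) : MvPolynomial (Fin m ⊕ Fin n) K :=
  MvPolynomial.rename Sum.inl (MvPolynomial.esymm (Fin m) K i)

/-- σ_j(y_1,…,y_n), viewed in K[x_1,…,x_m,y_1,…,y_n]. -/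
def sigmaY (K : Type*) [CommSemiring K] (m n j : ℕ) : MvPolynomial (Fin m ⊕ Fin n) K :=
  MvPolynomial.rename Sum.inr (MvPolynomial.esymm (Fin n) K j)

/-- The generators of the algebra `A_ns(m|n)` of nice supersymmetric polynomials:
`c_r` (r ≥ 0), `σ_i(x)^p` (1 ≤ i ≤ m), `σ_j(y)^p` (1 ≤ j ≤ n) and
`u_k = σ_m(x)^k σ_n(y)^{p-k}` (0 < k < p). -/
def nsGens (K : Type*) [CommRing K] (p m n : ℕ) : Set (MvPolynomial (Fin m ⊕ Fin n) K) :=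
  {f | ∃ r : ℕ, f = cpoly K m n r} ∪
  {f | ∃ i : ℕ, 1 ≤ i ∧ i ≤ m ∧ f = (sigmaX K m n i) ^ p} ∪
  {f | ∃ j : ℕ, 1 ≤ j ∧ j ≤ n ∧ f = (sigmaY K m n j) ^ p} ∪
  {f | ∃ k : ℕ, 0 < k ∧ k < p ∧ f = (sigmaX K m n m) ^ k * (sigmaY K m n n) ^ (p - k)}

/-- The evaluation morphism `p_e` sending `x_i ↦ x_i` (i ≤ m), `y_j ↦ y_j` (j ≤ n) and the
remaining variables to `0`. -/
def pe (K : Type*) [CommSemiring K] (M N m n : ℕ) :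
    MvPolynomial (Fin M ⊕ Fin N) K →ₐ[K] MvPolynomial (Fin m ⊕ Fin n) K :=
  MvPolynomial.aeval (Sum.elim
    (fun i : Fin M => if h : (i : ℕ) < m then MvPolynomial.X (Sum.inl ⟨(i : ℕ), h⟩) else 0)
    (fun j : Fin N => if h : (j : ℕ) < n then MvPolynomial.X (Sum.inr ⟨(j : ℕ), h⟩) else 0))

end

noncomputable section

/-- The generating series `∏ (1 + v i t)` of the elementary symmetric functions of `v`. -/
def elemSeries {ι R : Type*} [Fintype ι] [CommRing R] (v : ι → R) : PowerSeries R :=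
  ∏ i, (1 + PowerSeries.C (v i) * PowerSeries.X)

/-- The generating series `∏ (1 - v i t)⁻¹` of the complete symmetric functions of `v`. -/
def homSeries {ι R : Type*} [Fintype ι] [CommRing R] (v : ι → R) : PowerSeries R :=
  ∏ i, PowerSeries.mk (fun k => v i ^ k)

/-- The generating series `∏ (1 + x i t) / ∏ (1 + y j t)`. -/
def superSeries {α β R : Type*} [Fintype α] [Fintype β] [CommRing R] (x : α → R) (y : β → R) :
    PowerSeries R :=
  elemSeries x * homSeries (fun j => -y j)

section GeneratingSeries

variable {ι α β κ R S : Type*} [Fintype ι] [Fintype α] [Fintype β] [Fintype κ]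
  [CommRing R] [CommRing S]

theorem one_add_mul_geomSeries (a : R) :
    (1 + PowerSeries.C a * PowerSeries.X) * PowerSeries.mk (fun k => (-a) ^ k) = 1 := by
  ext k
  rw [add_mul, one_mul, map_add, mul_assoc, PowerSeries.coeff_C_mul]
  cases k with
  | zero => simp
  | succ k => simp [PowerSeries.coeff_succ_X_mul, PowerSeries.coeff_one, pow_succ, mul_comm]

theorem elemSeries_mul_homSeries (v : ι → R) :
    elemSeries v * homSeries (fun i => -v i) = 1 := by
  rw [elemSeries, homSeries, ← Finset.prod_mul_distrib]
  exact Finset.prod_eq_one fun i _ => one_add_mul_geomSeries (v i)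

theorem superSeries_mul_elemSeries (x : α → R) (y : β → R) :
    superSeries x y * elemSeries y = elemSeries x := by
  rw [superSeries, mul_assoc, mul_comm (homSeries _), elemSeries_mul_homSeries, mul_one]

theorem elemSeries_sum (v : ι ⊕ κ → R) :
    elemSeries v = elemSeries (fun i => v (Sum.inl i)) * elemSeries (fun i => v (Sum.inr i)) := by
  simp [elemSeries]

theorem homSeries_sum (v : ι ⊕ κ → R) :
    homSeries v = homSeries (fun i => v (Sum.inl i)) * homSeries (fun i => v (Sum.inr i)) := by
  simp [homSeries]

theorem elemSeries_comp_equiv (e : ι ≃ κ) (v : κ → R) :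
    elemSeries (fun i => v (e i)) = elemSeries v :=
  Equiv.prod_comp e fun i => 1 + PowerSeries.C (v i) * PowerSeries.X

theorem homSeries_comp_equiv (e : ι ≃ κ) (v : κ → R) :
    homSeries (fun i => v (e i)) = homSeries v :=
  Equiv.prod_comp e fun i => PowerSeries.mk fun k => v i ^ k

/-- Common parts of `x` and `y` cancel in `superSeries x y`. -/
theorem superSeries_cancel (x : α ⊕ κ → R) (y : β ⊕ κ → R)
    (h : ∀ t, x (Sum.inr t) = y (Sum.inr t)) :
    superSeries x y = superSeries (fun i => x (Sum.inl i)) (fun j => y (Sum.inl j)) := by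
  have h1 := elemSeries_mul_homSeries fun t => y (Sum.inr t)
  rw [superSeries, elemSeries_sum, homSeries_sum, superSeries]
  simp only [h]
  linear_combination (elemSeries (fun i => x (Sum.inl i)) *
    homSeries (fun i => -y (Sum.inl i))) * h1

theorem map_elemSeries (f : R →+* S) (v : ι → R) :
    PowerSeries.map f (elemSeries v) = elemSeries (fun i => f (v i)) := by
  simp [elemSeries]

theorem map_homSeries (f : R →+* S) (v : ι → R) :
    PowerSeries.map f (homSeries v) = homSeries (fun i => f (v i)) := by
  rw [homSeries, homSeries, map_prod]
  refine Finset.prod_congr rfl fun i _ => ?_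
  ext k
  simp

theorem map_superSeries (f : R →+* S) (x : α → R) (y : β → R) :
    PowerSeries.map f (superSeries x y) = superSeries (fun i => f (x i)) (fun j => f (y j)) := by
  simp [superSeries, map_elemSeries, map_homSeries]

theorem coeff_elemSeries (K : Type*) [CommRing K] [Algebra K R] (v : ι → R) (k : ℕ) :
    PowerSeries.coeff k (elemSeries v) = aeval v (esymm ι K k) := by
  classical
  have h : ∀ t : Finset ι, ∏ i ∈ t, (PowerSeries.C (v i) * PowerSeries.X) =
      PowerSeries.C (∏ i ∈ t, v i) * PowerSeries.X ^ t.card := by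
    intro t
    rw [Finset.prod_mul_distrib, Finset.prod_const, map_prod]
  rw [elemSeries, Finset.prod_one_add, map_sum, esymm, map_sum, Finset.powersetCard_eq_filter,
    Finset.sum_filter]
  refine Finset.sum_congr rfl fun t _ => ?_
  rw [h, PowerSeries.coeff_C_mul, PowerSeries.coeff_X_pow]
  simp [eq_comm]

theorem coeff_homSeries [DecidableEq ι] (K : Type*) [CommRing K] [Algebra K R] (v : ι → R)
    (k : ℕ) : PowerSeries.coeff k (homSeries v) = aeval v (hsymm ι K k) := by
  rw [homSeries, PowerSeries.coeff_prod, hsymm, map_sum]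
  symm
  refine Finset.sum_bij (fun s _ => Multiset.toFinsupp (s : Multiset ι)) ?_ ?_ ?_ ?_
  · intro s _
    rw [Finset.mem_finsuppAntidiag']
    refine ⟨?_, Finset.subset_univ _⟩
    exact (Multiset.toFinsupp_sum_eq (s : Multiset ι)).trans s.2
  · intro s _ t _ h
    exact Subtype.ext (Multiset.toFinsupp.injective h)
  · intro l hl
    rw [Finset.mem_finsuppAntidiag'] at hl
    refine ⟨⟨Finsupp.toMultiset l, ?_⟩, Finset.mem_univ _, ?_⟩
    · rw [Finsupp.card_toMultiset]
      exact hl.1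
    · simp
  · intro s _
    rw [map_multiset_prod, Multiset.map_map]
    simp only [Function.comp_def, aeval_X, PowerSeries.coeff_mk, Multiset.toFinsupp_apply]
    exact Finset.prod_multiset_map_count _ _ |>.trans
      (Finset.prod_subset (Finset.subset_univ _) (by simp_all))

theorem homSeries_neg_coeff [DecidableEq ι] (K : Type*) [CommRing K] [Algebra K R] (v : ι → R)
    (k : ℕ) : PowerSeries.coeff k (homSeries fun i => -v i) = (-1) ^ k * aeval v (hsymm ι K k) := by
  rw [coeff_homSeries K, hsymm, map_sum, map_sum, Finset.mul_sum]
  refine Finset.sum_congr rfl fun s _ => ?_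
  rw [map_multiset_prod, map_multiset_prod, Multiset.map_map, Multiset.map_map]
  have h : Multiset.map (⇑(aeval (R := K) fun i => -v i) ∘ X) (s : Multiset ι) =
      Multiset.map Neg.neg (Multiset.map (⇑(aeval (R := K) v) ∘ X) (s : Multiset ι)) := by
    simp [Multiset.map_map]
  refine (congrArg Multiset.prod h).trans ((Multiset.prod_map_neg _).trans ?_)
  rw [Multiset.card_map]
  exact congrArg₂ _ (congrArg _ s.2) rfl

end GeneratingSeries

theorem esymm_eq_zero_of_card_lt {ι K : Type*} [Fintype ι] [CommRing K] {k : ℕ}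
    (h : Fintype.card ι < k) : esymm ι K k = 0 := by
  rw [esymm, Finset.powersetCard_eq_empty.2 (by simpa using h), Finset.sum_empty]

/-- A polynomial `c_r` is the coefficient of `t ^ r` in the generating series. -/
theorem map_cpoly {K R : Type*} [CommRing K] [CommRing R] [Algebra K R] {m n : ℕ}
    (f : MvPolynomial (Fin m ⊕ Fin n) K →ₐ[K] R) (r : ℕ) :
    f (cpoly K m n r) = PowerSeries.coeff r
      (superSeries (fun i => f (X (Sum.inl i))) (fun j => f (X (Sum.inr j)))) := by
  have h1 : ∀ s : MvPolynomial (Fin m) K,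
      f (rename Sum.inl s) = aeval (fun i => f (X (Sum.inl i))) s := fun s => by
    rw [← AlgHom.comp_apply, aeval_unique (f.comp _)]
    simp [Function.comp_def]
  have h2 : ∀ s : MvPolynomial (Fin n) K,
      f (rename Sum.inr s) = aeval (fun j => f (X (Sum.inr j))) s := fun s => by
    rw [← AlgHom.comp_apply, aeval_unique (f.comp _)]
    simp [Function.comp_def]
  rw [superSeries, PowerSeries.coeff_mul, Finset.Nat.sum_antidiagonal_eq_sum_range_succ_mk, cpoly,
    map_sum]
  symm
  refine (Finset.sum_subset (Finset.range_mono (by omega)) ?_).symm.trans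
    (Finset.sum_congr rfl ?_)
  · intro i hi hi'
    rw [Finset.mem_range] at hi hi'
    rw [coeff_elemSeries K, esymm_eq_zero_of_card_lt (by rw [Fintype.card_fin]; omega)]
    simp
  · intro i hi
    rw [map_mul, map_mul, map_pow, map_neg, map_one, h1, h2, coeff_elemSeries K,
      homSeries_neg_coeff K]
    ring

section Conductor

variable {α R : Type*} [CommRing R]

theorem coeff_prod_one_add_mul_geomSeries (x : α → R) (z : R) (t : Finset α) (s : ℕ) :
    PowerSeries.coeff (t.card + s) ((∏ i ∈ t, (1 + PowerSeries.C (x i) * PowerSeries.X)) *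
      PowerSeries.mk fun k => z ^ k) = z ^ s * ∏ i ∈ t, (x i + z) := by
  classical
  induction t using Finset.induction_on generalizing s with
  | empty => simp
  | insert a t ha ih =>
    have h := ih (s + 1)
    rw [Finset.prod_insert ha, Finset.prod_insert ha, Finset.card_insert_of_notMem ha, mul_assoc,
      add_mul, one_mul, map_add, mul_assoc, PowerSeries.coeff_C_mul,
      show t.card + 1 + s = t.card + s + 1 by ring, PowerSeries.coeff_succ_X_mul, ih,
      show t.card + s + 1 = t.card + (s + 1) by ring, ih]
    ring

theorem coeff_prod_one_add_eq_zero {ι : Type*} (y : ι → R) (t : Finset ι) {k : ℕ}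
    (hk : t.card < k) :
    PowerSeries.coeff k (∏ i ∈ t, (1 + PowerSeries.C (y i) * PowerSeries.X)) = 0 := by
  classical
  induction t using Finset.induction_on generalizing k with
  | empty =>
    rw [Finset.prod_empty, PowerSeries.coeff_one, if_neg (by simp at hk; omega)]
  | insert a t ha ih =>
    rw [Finset.card_insert_of_notMem ha] at hk
    obtain ⟨k, rfl⟩ : ∃ j, k = j + 1 := ⟨k - 1, by omega⟩
    rw [Finset.prod_insert ha, add_mul, one_mul, map_add, mul_assoc, PowerSeries.coeff_C_mul,
      PowerSeries.coeff_succ_X_mul, ih (by omega), ih (by omega)]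
    simp

theorem coeff_mul_eq_sum_fin {n r : ℕ} (f g : PowerSeries R)
    (hg : ∀ j, n ≤ j → PowerSeries.coeff j g = 0) :
    PowerSeries.coeff r (f * g) = ∑ j : Fin n,
      (if (j : ℕ) ≤ r then PowerSeries.coeff (r - j) f else 0) * PowerSeries.coeff (j : ℕ) g := by
  rw [Fin.sum_univ_eq_sum_range
    (fun j => (if j ≤ r then PowerSeries.coeff (r - j) f else 0) * PowerSeries.coeff j g) n,
    mul_comm, PowerSeries.coeff_mul, Finset.Nat.sum_antidiagonal_eq_sum_range_succ_mk]
  have h1 : ∑ j ∈ Finset.range (r + 1), PowerSeries.coeff j g * PowerSeries.coeff (r - j) f =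
      ∑ j ∈ Finset.range (r + 1),
        (if j ≤ r then PowerSeries.coeff (r - j) f else 0) * PowerSeries.coeff j g := by
    refine Finset.sum_congr rfl fun j hj => ?_
    rw [if_pos (by rw [Finset.mem_range] at hj; omega), mul_comm]
  have h2 : Finset.range (r + 1) ⊆ Finset.range (n + r + 1) := Finset.range_mono (by omega)
  have h3 : Finset.range n ⊆ Finset.range (n + r + 1) := Finset.range_mono (by omega)
  refine h1.trans ((Finset.sum_subset h2 fun j _ hj => ?_).trans
    (Finset.sum_subset h3 fun j _ hj => ?_).symm)
  · rw [if_neg (by rw [Finset.mem_range] at hj; omega), zero_mul]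
  · rw [hg j (by rw [Finset.mem_range] at hj; omega), mul_zero]

variable [Fintype α]

/-- The matrix of coefficients `c_{m + I i - j}` of the supersymmetric generating series. -/
def superMatrix {n : ℕ} (x : α → R) (y : Fin n → R) (I : Fin n → ℕ) : Matrix (Fin n) (Fin n) R :=
  Matrix.of fun i j => if (j : ℕ) ≤ Fintype.card α + I i then
    PowerSeries.coeff (Fintype.card α + I i - j) (superSeries x y) else 0

/-- The matrix of elementary symmetric functions of the variables `y` with one of them omitted. -/
def omitMatrix {n : ℕ} (y : Fin n → R) : Matrix (Fin n) (Fin n) R :=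
  Matrix.of fun j l => PowerSeries.coeff (j : ℕ)
    (∏ i ∈ Finset.univ.erase l, (1 + PowerSeries.C (y i) * PowerSeries.X))

theorem det_superMatrix_mul {n : ℕ} (x : α → R) (y : Fin n → R) (I : Fin n → ℕ) :
    (superMatrix x y I).det * (omitMatrix y).det =
      (∏ l, ∏ i, (x i - y l)) * (Matrix.of fun i l => (-y l) ^ I i).det := by
  rw [← Matrix.det_mul, ← Matrix.det_mul_row]
  congr 1
  ext i l
  have h1 : superSeries x y *
      (∏ i ∈ Finset.univ.erase l, (1 + PowerSeries.C (y i) * PowerSeries.X)) =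
      elemSeries x * PowerSeries.mk fun k => (-y l) ^ k := by
    have h2 := superSeries_mul_elemSeries x y
    rw [elemSeries, ← Finset.mul_prod_erase _ _ (Finset.mem_univ l)] at h2
    have h3 := one_add_mul_geomSeries (y l)
    linear_combination (PowerSeries.mk fun k => (-y l) ^ k) * h2 -
      (superSeries x y * ∏ i ∈ Finset.univ.erase l,
        (1 + PowerSeries.C (y i) * PowerSeries.X)) * h3
  have h4 := coeff_mul_eq_sum_fin (n := n) (r := Fintype.card α + I i) (superSeries x y)
    (∏ i ∈ Finset.univ.erase l, (1 + PowerSeries.C (y i) * PowerSeries.X)) fun j hj =>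
      coeff_prod_one_add_eq_zero y _ (by
        rw [Finset.card_erase_of_mem (Finset.mem_univ l), Finset.card_univ, Fintype.card_fin]
        have := l.2
        omega)
  rw [h1, elemSeries, ← Finset.card_univ, coeff_prod_one_add_mul_geomSeries] at h4
  rw [Matrix.mul_apply]
  refine h4.symm.trans ?_
  simp [mul_comm, sub_eq_add_neg]

theorem det_omitMatrix {n : ℕ} (y : Fin n → R) :
    (omitMatrix y).det = (Matrix.of fun i l : Fin n => (-y l) ^ (i : ℕ)).det := by
  have h := det_superMatrix_mul (fun i : Fin 0 => i.elim0) y fun i => (i : ℕ)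
  have h1 : (superMatrix (fun i : Fin 0 => i.elim0) y fun i => (i : ℕ)).det = 1 := by
    rw [Matrix.det_of_isLowerTriangular]
    · refine Finset.prod_eq_one fun i _ => ?_
      simp [superMatrix, superSeries, elemSeries, homSeries,
        ← PowerSeries.coeff_zero_eq_constantCoeff_apply]
    · intro i j hij
      have hij' : i < j := hij
      simp only [superMatrix, Matrix.of_apply, Fintype.card_fin, zero_add]
      rw [if_neg]
      have : (i : ℕ) < j := hij'
      omega
  rw [h1, one_mul] at h
  simpa using h

theorem aeval_mul_det_eq_sum {K : Type*} [CommRing K] [Algebra K R] {n : ℕ} (z : Fin n → R)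
    {s : MvPolynomial (Fin n) K} (hs : s.IsSymmetric) (I : Fin n → ℕ) :
    aeval z s * (Matrix.of fun i l : Fin n => z l ^ I i).det =
      ∑ a ∈ s.support, coeff a s • (Matrix.of fun i l : Fin n => z l ^ (a i + I i)).det := by
  have h : ∀ σ : Equiv.Perm (Fin n), aeval z s =
      ∑ a ∈ s.support, coeff a s • ∏ l, z l ^ a (σ l) := by
    intro σ
    conv_lhs => rw [← hs σ.symm, aeval_rename, aeval_def, eval₂_eq']
    refine Finset.sum_congr rfl fun a _ => ?_
    rw [Algebra.smul_def, ← Equiv.prod_comp σ]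
    simp
  simp only [Matrix.det_apply', Finset.mul_sum, Finset.smul_sum]
  rw [Finset.sum_comm]
  refine Finset.sum_congr rfl fun σ _ => ?_
  rw [h σ, Finset.sum_mul]
  refine Finset.sum_congr rfl fun a _ => ?_
  simp only [Matrix.of_apply, pow_add, Finset.prod_mul_distrib, Algebra.smul_def]
  ring

theorem subalgebra_det_mem {K : Type*} [CommRing K] [Algebra K R] (A : Subalgebra K R)
    {n : ℕ} (M : Matrix (Fin n) (Fin n) R) (h : ∀ i j, M i j ∈ A) : M.det ∈ A := by
  rw [Matrix.det_apply']
  refine sum_mem fun σ _ => mul_mem ?_ (prod_mem fun i _ => h _ _)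
  exact intCast_mem A _

/-- The product of all differences `x i - y l` conducts the symmetric functions of `y` into the
algebra generated by the supersymmetric functions `c_r`. -/
theorem prod_sub_mul_aeval_mem {K : Type*} [CommRing K] [Algebra K R] [IsDomain R] {n : ℕ}
    (x : α → R) (y : Fin n → R) (hy : Function.Injective y) (A : Subalgebra K R)
    (hA : ∀ r, PowerSeries.coeff r (superSeries x y) ∈ A)
    {s : MvPolynomial (Fin n) K} (hs : s.IsSymmetric) :
    (∏ l, ∏ i, (x i - y l)) * aeval y s ∈ A := by
  set s' : MvPolynomial (Fin n) K := aeval (fun i => -X i) s with hs'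
  have hsym : s'.IsSymmetric := by
    intro σ
    rw [hs']
    conv_rhs => rw [← hs σ, aeval_rename]
    rw [← AlgHom.comp_apply, comp_aeval]
    simp [Function.comp_def]
  have hval : aeval (fun i => -y i) s' = aeval y s := by
    rw [hs', ← AlgHom.comp_apply, comp_aeval]
    simp
  have hne : (omitMatrix y).det ≠ 0 := by
    rw [det_omitMatrix, ← Matrix.det_transpose]
    exact Matrix.det_vandermonde_ne_zero_iff.2 fun i j hij => hy (neg_injective hij)
  have key : (∏ l, ∏ i, (x i - y l)) * aeval y s =
      ∑ a ∈ s'.support, coeff a s' • (superMatrix x y fun i => a i + i).det := by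
    refine mul_right_cancel₀ hne ?_
    rw [Finset.sum_mul]
    simp only [smul_mul_assoc, det_superMatrix_mul]
    rw [det_omitMatrix, mul_assoc, ← hval, aeval_mul_det_eq_sum _ hsym, Finset.mul_sum]
    simp only [mul_smul_comm]
  rw [key]
  refine sum_mem fun a _ => A.smul_mem (subalgebra_det_mem A _ fun i j => ?_) _
  rw [superMatrix, Matrix.of_apply]
  split_ifs
  · exact hA _
  · exact zero_mem A

end Conductor

section Symmetric

variable {K : Type*} [CommRing K] {σ ρ : Type*}

theorem sumAlgEquiv_rename_inr (f : ρ → ρ) (h : MvPolynomial (σ ⊕ ρ) K) :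
    sumAlgEquiv K σ ρ (rename (Sum.map id f) h) =
      map (rename f : MvPolynomial ρ K →ₐ[K] MvPolynomial ρ K).toRingHom
        (sumAlgEquiv K σ ρ h) := by
  induction h using MvPolynomial.induction_on with
  | C a => simp [sumAlgEquiv_C_inl]
  | add p q hp hq => simp_all
  | mul_X p i hp => cases i <;> simp_all

theorem sumAlgEquiv_rename_inl (f : σ → σ) (h : MvPolynomial (σ ⊕ ρ) K) :
    sumAlgEquiv K σ ρ (rename (Sum.map f id) h) = rename f (sumAlgEquiv K σ ρ h) := by
  induction h using MvPolynomial.induction_on with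
  | C a => simp [sumAlgEquiv_C_inl]
  | add p q hp hq => simp_all
  | mul_X p i hp => cases i <;> simp_all

theorem coeff_sumAlgEquiv_pderiv_inr (t : ρ) (h : MvPolynomial (σ ⊕ ρ) K) (a : σ →₀ ℕ) :
    coeff a (sumAlgEquiv K σ ρ (pderiv (Sum.inr t) h)) =
      pderiv t (coeff a (sumAlgEquiv K σ ρ h)) := by
  classical
  induction h using MvPolynomial.induction_on generalizing a with
  | C b => simp [sumAlgEquiv_C_inl, coeff_C]; split_ifs <;> simp
  | add p q hp hq => simp_all
  | mul_X p i hp =>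
    cases i with
    | inl i =>
      simp only [Derivation.leibniz, smul_eq_mul, map_mul, sumAlgEquiv_X_inl,
        pderiv_X_of_ne (Sum.inl_ne_inr : Sum.inl i ≠ Sum.inr t), mul_zero, zero_add, coeff_mul_X']
      rw [mul_comm, coeff_mul_X']
      split_ifs
      · exact hp _
      · simp
    | inr i =>
      have h1 : ∀ q : MvPolynomial σ (MvPolynomial ρ K), ∀ c,
          coeff a (q * C c) = coeff a q * c := fun q c => by rw [mul_comm, coeff_C_mul, mul_comm]
      simp only [Derivation.leibniz, map_add, smul_eq_mul, map_mul, sumAlgEquiv_X_inr, coeff_add,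
        pderiv_X, Pi.single_apply, Sum.inr.injEq, coeff_C_mul, h1, hp]
      split_ifs <;> simp

/-- The fundamental theorem on symmetric polynomials in one of two groups of variables, with
control on the coefficients. -/
theorem mem_of_symmetric_inl [Fintype σ] {h : MvPolynomial (σ ⊕ ρ) K}
    (hh : ∀ π : Equiv.Perm σ, rename (Sum.map π id) h = h) (A : Subalgebra K (MvPolynomial ρ K))
    (hA : ∀ a, coeff a (sumAlgEquiv K σ ρ h) ∈ A) (S : Subalgebra K (MvPolynomial (σ ⊕ ρ) K))
    (hS : ∀ i, rename Sum.inl (esymm σ K i) ∈ S) (hAS : A ≤ S.comap (rename Sum.inr)) :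
    h ∈ S := by
  obtain ⟨Q, hQ⟩ : ∃ Q : MvPolynomial σ A, map A.val.toRingHom Q = sumAlgEquiv K σ ρ h := by
    refine mem_range_map_iff_coeffs_subset.2 ?_
    intro c hc
    obtain ⟨a, _, rfl⟩ := mem_coeffs_iff.1 hc
    exact ⟨⟨_, hA a⟩, rfl⟩
  have hQs : Q.IsSymmetric := by
    intro π
    refine map_injective A.val.toRingHom Subtype.val_injective ?_
    rw [map_rename, hQ, ← sumAlgEquiv_rename_inl, hh π]
  obtain ⟨q, hq⟩ := esymmAlgHom_surjective (σ := σ) A le_rfl ⟨Q, hQs⟩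
  have hq' : Q = aeval (fun i : Fin (Fintype.card σ) ↦ esymm σ A (i + 1)) q := by
    rw [← esymmAlgHom_apply, hq]
  have key : ∀ q : MvPolynomial (Fin (Fintype.card σ)) A, (sumAlgEquiv K σ ρ).symm
      (map A.val.toRingHom (aeval (fun i : Fin (Fintype.card σ) ↦ esymm σ A (i + 1)) q)) ∈ S := by
    intro q
    induction q using MvPolynomial.induction_on with
    | C a =>
      have h1 : (sumAlgEquiv K σ ρ).symm (C (a : MvPolynomial ρ K)) = rename Sum.inr a.1 := by
        rw [AlgEquiv.symm_apply_eq]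
        exact (AlgHom.congr_fun (sumAlgEquiv_comp_rename_inr K σ ρ) a.1).symm
      simpa [algebraMap_eq, h1] using hAS a.2
    | add p q hp hq => simpa using add_mem hp hq
    | mul_X p i hp =>
      have h1 : (sumAlgEquiv K σ ρ).symm (esymm σ (MvPolynomial ρ K) (i + 1)) =
          rename Sum.inl (esymm σ K (i + 1)) := by
        rw [AlgEquiv.symm_apply_eq, esymm, esymm]
        simp
      simp only [map_mul, aeval_X, map_esymm, h1]
      exact mul_mem hp (hS _)
  rw [← (sumAlgEquiv K σ ρ).symm_apply_apply h, ← hQ, hq']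
  exact key q

theorem exists_expand_of_pderiv_eq_zero {K : Type*} [Field K] {p : ℕ} [CharP K p]
    (g : MvPolynomial σ K) (hg : ∀ t, pderiv t g = 0) : ∃ g', expand p g' = g := by
  classical
  have hdvd : ∀ a ∈ g.support, ∀ t, p ∣ a t := by
    intro a ha t
    rcases Nat.eq_zero_or_pos (a t) with h0 | h0
    · simp [h0]
    have h1 := coeff_pderiv (i := t) g (a - Finsupp.single t 1)
    have h2 : a - Finsupp.single t 1 + Finsupp.single t 1 = a := by
      ext s
      by_cases hs : t = s
      · subst hs; simp; omega
      · simp [hs]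
    rw [hg t, coeff_zero, h2] at h1
    have h3 := (mul_eq_zero.1 h1.symm).resolve_left (mem_support_iff.1 ha)
    have h4 : (((a t : ℕ)) : K) = 0 := by
      rw [← h3]
      have : a t = (a t - 1) + 1 := by omega
      conv_lhs => rw [this]
      simp
    exact (CharP.cast_eq_zero_iff K p _).1 h4
  refine ⟨∑ a ∈ g.support, monomial (a.mapRange (· / p) (Nat.zero_div p)) (coeff a g), ?_⟩
  rw [map_sum]
  conv_rhs => rw [g.as_sum]
  refine Finset.sum_congr rfl fun a ha => ?_
  have h : p • a.mapRange (· / p) (Nat.zero_div p) = a := by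
    ext t
    simpa using Nat.mul_div_cancel' (hdvd a ha t)
  rw [expand_monomial, h]

theorem aeval_mem_subalgebra {R : Type*} [CommRing R] [Algebra K R] (A : Subalgebra K R)
    {v : σ → R} (q : MvPolynomial σ K) (h : ∀ i, v i ∈ A) : aeval v q ∈ A := by
  induction q using MvPolynomial.induction_on with
  | C a => simp
  | add p q hp hq => simpa using add_mem hp hq
  | mul_X p i hp => simpa using mul_mem hp (h i)

/-- Polynomials symmetric in three groups of variables and with vanishing partial derivatives in the
last group lie in the algebra generated by the elementary symmetric functions of the variables of
the first two groups and of the `p`-th powers of the variables of the third group. -/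
theorem mem_of_symmetric_of_pderiv {K α β κ : Type*} [Field K] [Fintype α] [Fintype β] [Fintype κ]
    {p : ℕ} [CharP K p] (hp : p ≠ 0) {h : MvPolynomial (α ⊕ β ⊕ κ) K}
    (hα : ∀ π : Equiv.Perm α, rename (Sum.map π id) h = h)
    (hβ : ∀ π : Equiv.Perm β, rename (Sum.map id (Sum.map π id)) h = h)
    (hκ : ∀ π : Equiv.Perm κ, rename (Sum.map id (Sum.map id π)) h = h)
    (hd : ∀ t, pderiv (Sum.inr (Sum.inr t)) h = 0)
    (S : Subalgebra K (MvPolynomial (α ⊕ β ⊕ κ) K))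
    (hSα : ∀ i, rename Sum.inl (esymm α K i) ∈ S)
    (hSβ : ∀ i, rename (fun j => Sum.inr (Sum.inl j)) (esymm β K i) ∈ S)
    (hSκ : ∀ i, rename (fun t => Sum.inr (Sum.inr t)) (expand p (esymm κ K i)) ∈ S) :
    h ∈ S := by
  refine mem_of_symmetric_inl hα (S.comap (rename Sum.inr)) (fun a => ?_) S hSα le_rfl
  set u := coeff a (sumAlgEquiv K α (β ⊕ κ) h) with hu
  have huβ : ∀ π : Equiv.Perm β, rename (Sum.map π id) u = u := fun π => by
    conv_rhs => rw [hu, ← hβ π, sumAlgEquiv_rename_inr, coeff_map]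
    rfl
  have huκ : ∀ π : Equiv.Perm κ, rename (Sum.map id π) u = u := fun π => by
    conv_rhs => rw [hu, ← hκ π, sumAlgEquiv_rename_inr, coeff_map]
    rfl
  have hud : ∀ t, pderiv (Sum.inr t) u = 0 := fun t => by
    rw [hu, ← coeff_sumAlgEquiv_pderiv_inr, hd]
    simp
  refine mem_of_symmetric_inl huβ ((S.comap (rename Sum.inr)).comap (rename Sum.inr)) (fun b => ?_)
    _ (fun i => ?_) le_rfl
  · set g := coeff b (sumAlgEquiv K β κ u) with hg
    have hgκ : ∀ π : Equiv.Perm κ, rename π g = g := fun π => by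
      conv_rhs => rw [hg, ← huκ π, sumAlgEquiv_rename_inr, coeff_map]
      rfl
    obtain ⟨g', hg'⟩ := exists_expand_of_pderiv_eq_zero (p := p) g fun t => by
      rw [hg, ← coeff_sumAlgEquiv_pderiv_inr, hud]
      simp
    have hgs : g'.IsSymmetric := fun π => by
      refine expand_injective (Nat.pos_of_ne_zero hp) ?_
      rw [← rename_expand, hg', hgκ]
    obtain ⟨q, hq⟩ := esymmAlgHom_surjective (σ := κ) K le_rfl ⟨g', hgs⟩
    have hq' : g' = aeval (fun i : Fin (Fintype.card κ) ↦ esymm κ K (i + 1)) q := by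
      rw [← esymmAlgHom_apply, hq]
    have h1 : aeval (fun i : Fin (Fintype.card κ) ↦ esymm κ K (i + 1)) q ∈
        (((S.comap (rename Sum.inr)).comap (rename Sum.inr)).comap (expand p)) := by
      refine aeval_mem_subalgebra _ q fun i => ?_
      simpa [rename_rename, Function.comp_def] using hSκ (i + 1)
    rw [← hg', hq']
    exact h1
  · simpa [rename_rename, Function.comp_def] using hSβ i

end Symmetric

section Image

/-- The identification of variables that pairs each of the variables `x i`, `i ∈ κ`, with the
corresponding variable `y i`. -/
def glue {ι ι' α β κ : Type*} (eX : ι ≃ α ⊕ κ) (eY : ι' ≃ β ⊕ κ) : ι ⊕ ι' → α ⊕ β ⊕ κ :=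
  Sum.elim (fun i => Sum.map id Sum.inr (eX i)) (fun j => Sum.inr (eY j))

theorem coeff_mul_mem {K R : Type*} [CommRing K] [CommRing R] [Algebra K R] {A : Subalgebra K R}
    {f g : PowerSeries R} (hf : ∀ r, PowerSeries.coeff r f ∈ A)
    (hg : ∀ r, PowerSeries.coeff r g ∈ A) (r : ℕ) : PowerSeries.coeff r (f * g) ∈ A := by
  rw [PowerSeries.coeff_mul]
  exact sum_mem fun i _ => mul_mem (hf _) (hg _)

theorem coeff_elemSeries_pow {ι R : Type*} [Fintype ι] [CommRing R] (p : ℕ) [ExpChar R p]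
    (v : ι → R) (r : ℕ) :
    PowerSeries.coeff r (elemSeries fun i => v i ^ p) = PowerSeries.coeff r (elemSeries v) ^ p := by
  have h := map_elemSeries (frobenius R p) v
  simp only [frobenius_def] at h
  rw [← h, PowerSeries.coeff_map, frobenius_def]

variable {K : Type*} [Field K] {p : ℕ} {m n b : ℕ} {α κ : Type*} [Fintype κ]

theorem coeff_superSeries_mem_map_adjoin [Fintype α] (eX : Fin m ≃ α ⊕ κ)
    (eY : Fin n ≃ Fin b ⊕ κ) (r : ℕ) :
    PowerSeries.coeff r (superSeries (fun i => X (Sum.inl i)) fun j => X (Sum.inr (Sum.inl j))) ∈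
      (Algebra.adjoin K (nsGens K p m n)).map
        (rename (glue eX eY) : _ →ₐ[K] MvPolynomial (α ⊕ Fin b ⊕ κ) K) := by
  refine ⟨cpoly K m n r, Algebra.subset_adjoin (Or.inl (Or.inl (Or.inl ⟨r, rfl⟩))), ?_⟩
  have h := superSeries_cancel (R := MvPolynomial (α ⊕ Fin b ⊕ κ) K)
    (fun i : α ⊕ κ => X (Sum.map id Sum.inr i)) (fun j : Fin b ⊕ κ => X (Sum.inr j)) fun _ => rfl
  refine (map_cpoly (rename (glue eX eY)) r).trans ?_
  have h2 : superSeries (fun i => X (Sum.map id Sum.inr (eX i))) (fun j => X (Sum.inr (eY j))) =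
      superSeries (R := MvPolynomial (α ⊕ Fin b ⊕ κ) K)
        (fun i => X (Sum.map id Sum.inr i)) (fun j => X (Sum.inr j)) :=
    congrArg₂ (· * ·) (elemSeries_comp_equiv eX fun i => X (Sum.map id Sum.inr i))
      (homSeries_comp_equiv eY fun j => -X (Sum.inr j))
  simp only [rename_X, glue, Sum.elim_inl, Sum.elim_inr, h2]
  rw [h]
  rfl

theorem coeff_elemSeries_pow_mem_map_adjoin [Fact p.Prime] [CharP K p] (eX : Fin m ≃ α ⊕ κ)
    (eY : Fin n ≃ Fin b ⊕ κ) (r : ℕ) :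
    PowerSeries.coeff r (elemSeries fun j : Fin b ⊕ κ => X (Sum.inr j) ^ p) ∈
      (Algebra.adjoin K (nsGens K p m n)).map
        (rename (glue eX eY) : _ →ₐ[K] MvPolynomial (α ⊕ Fin b ⊕ κ) K) := by
  have : ExpChar (MvPolynomial (α ⊕ Fin b ⊕ κ) K) p := ExpChar.prime Fact.out
  have h : PowerSeries.coeff r (elemSeries fun j : Fin b ⊕ κ => X (Sum.inr j) ^ p) =
      rename (glue eX eY) (sigmaY K m n r ^ p) := by
    rw [coeff_elemSeries_pow, ← elemSeries_comp_equiv eY fun j => X (Sum.inr j),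
      coeff_elemSeries K, sigmaY, map_pow, rename_rename, MvPolynomial.rename_eq_aeval]
    rfl
  rw [h]
  refine Subalgebra.mem_map.2 ⟨_, ?_, rfl⟩
  rcases Nat.eq_zero_or_pos r with rfl | h0
  · simp [sigmaY]
  · rcases le_or_gt r n with h1 | h1
    · exact Algebra.subset_adjoin (Or.inl (Or.inr ⟨r, h0, h1, rfl⟩))
    · rw [sigmaY, esymm_eq_zero_of_card_lt (by simpa using h1), map_zero,
        zero_pow (Fact.out : p.Prime).ne_zero]
      exact zero_mem _

/-- The product of all differences `x i - y l` conducts the polynomials with the symmetries of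
identified supersymmetric polynomials into the image of the algebra of nice ones. -/
theorem prod_sub_mul_mem_map_adjoin [Fintype α] [Fact p.Prime] [CharP K p] (eX : Fin m ≃ α ⊕ κ)
    (eY : Fin n ≃ Fin b ⊕ κ) {h : MvPolynomial (α ⊕ Fin b ⊕ κ) K}
    (hα : ∀ π : Equiv.Perm α, rename (Sum.map π id) h = h)
    (hβ : ∀ π : Equiv.Perm (Fin b), rename (Sum.map id (Sum.map π id)) h = h)
    (hκ : ∀ π : Equiv.Perm κ, rename (Sum.map id (Sum.map id π)) h = h)
    (hd : ∀ t, pderiv (Sum.inr (Sum.inr t)) h = 0) :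
    (∏ l : Fin b, ∏ i : α, (X (Sum.inl i) - X (Sum.inr (Sum.inl l)))) * h ∈
      (Algebra.adjoin K (nsGens K p m n)).map (rename (glue eX eY)) := by
  set T := (Algebra.adjoin K (nsGens K p m n)).map
    (rename (glue eX eY) : _ →ₐ[K] MvPolynomial (α ⊕ Fin b ⊕ κ) K) with hT
  set x : α → MvPolynomial (α ⊕ Fin b ⊕ κ) K := fun i => X (Sum.inl i) with hx
  set y : Fin b → MvPolynomial (α ⊕ Fin b ⊕ κ) K := fun j => X (Sum.inr (Sum.inl j)) with hy
  set Λ := (symmetricSubalgebra (Fin b) K).map (aeval y) with hΛ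
  have hTc : ∀ r, PowerSeries.coeff r (superSeries x y) ∈ T :=
    coeff_superSeries_mem_map_adjoin eX eY
  have hΛy : ∀ r, PowerSeries.coeff r (elemSeries y) ∈ Λ := fun r =>
    ⟨esymm _ K r, esymm_isSymmetric _ K r, (coeff_elemSeries K y r).symm⟩
  have hΛp : ∀ r, PowerSeries.coeff r (homSeries fun j => -y j ^ p) ∈ Λ := fun r => by
    rw [homSeries_neg_coeff K]
    refine mul_mem (pow_mem (neg_mem (one_mem _)) _) ⟨expand p (hsymm _ K r), fun π => ?_, ?_⟩
    · rw [rename_expand, hsymm_isSymmetric]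
    · exact aeval_expand _ _ _
  have hU : h ∈ T ⊔ Λ := by
    refine mem_of_symmetric_of_pderiv (Fact.out : p.Prime).ne_zero hα hβ hκ hd _
      (fun i => ?_) (fun i => ?_) fun i => ?_
    · have h1 : rename Sum.inl (esymm α K i) =
          PowerSeries.coeff i (superSeries x y * elemSeries y) := by
        rw [superSeries_mul_elemSeries, coeff_elemSeries K, rename_eq_aeval]
        rfl
      rw [h1]
      exact coeff_mul_mem (fun r => (le_sup_left : T ≤ T ⊔ Λ) (hTc r))
        (fun r => (le_sup_right : Λ ≤ T ⊔ Λ) (hΛy r)) i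
    · have h1 : rename (fun j => Sum.inr (Sum.inl j)) (esymm (Fin b) K i) =
          PowerSeries.coeff i (elemSeries y) := by
        rw [coeff_elemSeries K, rename_eq_aeval]
        rfl
      rw [h1]
      exact (le_sup_right : Λ ≤ T ⊔ Λ) (hΛy i)
    · have h1 : rename (fun t => Sum.inr (Sum.inr t)) (expand p (esymm κ K i)) =
          PowerSeries.coeff i ((elemSeries fun j : Fin b ⊕ κ => X (Sum.inr j) ^ p) *
            homSeries fun j => -y j ^ p) := by
        have h2 := elemSeries_mul_homSeries fun j => y j ^ p
        rw [elemSeries_sum, mul_comm, ← mul_assoc, mul_comm (homSeries _), h2, one_mul,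
          coeff_elemSeries K, rename_eq_aeval, aeval_expand]
        rfl
      rw [h1]
      exact coeff_mul_mem (fun r => (le_sup_left : T ≤ T ⊔ Λ)
        (coeff_elemSeries_pow_mem_map_adjoin eX eY r))
        (fun r => (le_sup_right : Λ ≤ T ⊔ Λ) (hΛp r)) i
  have hyi : Function.Injective y := fun i j hij => by simpa [hy] using hij
  rw [← Subalgebra.mem_toSubmodule, ← Subalgebra.mul_toSubmodule] at hU
  refine Submodule.mul_induction_on hU ?_ fun a b ha hb => by rw [mul_add]; exact add_mem ha hb
  rintro u hu _ ⟨s, hs, rfl⟩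
  rw [mul_left_comm]
  exact mul_mem hu (prod_sub_mul_aeval_mem x y hyi T hTc hs)

end Image

section Vanishing

theorem X_sub_X_dvd_sub_rename {σ K : Type*} [CommRing K] [DecidableEq σ] (v w : σ)
    (g : MvPolynomial σ K) : X v - X w ∣ g - rename (Function.update id w v) g := by
  induction g using MvPolynomial.induction_on with
  | C a => simp
  | add p q hp hq =>
    rw [map_add, add_sub_add_comm]
    exact dvd_add hp hq
  | mul_X p i hp =>
    rw [map_mul, rename_X]
    have h : X v - X w ∣ (X i : MvPolynomial σ K) - X (Function.update id w v i) := by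
      by_cases hi : i = w
      · subst hi
        rw [Function.update_self, ← neg_sub, neg_dvd]
      · simp [hi]
    have h2 := dvd_add (hp.mul_right (X i)) (h.mul_left (rename (Function.update id w v) p))
    rwa [sub_mul, mul_sub, sub_add_sub_cancel] at h2

variable {K : Type*} [Field K] {α β κ : Type*} [DecidableEq α] [DecidableEq β] [DecidableEq κ]

theorem prod_sub_dvd_of_rename_eq_zero (P : Finset (β × α)) (g : MvPolynomial (α ⊕ β ⊕ κ) K)
    (hg : ∀ c ∈ P, rename (Function.update id (Sum.inr (Sum.inl c.1)) (Sum.inl c.2)) g = 0) :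
    ∏ c ∈ P, (X (Sum.inl c.2) - X (Sum.inr (Sum.inl c.1))) ∣ g := by
  induction P using Finset.induction_on with
  | empty => simp
  | insert c P hc ih =>
    obtain ⟨h, rfl⟩ := ih fun d hd => hg d (Finset.mem_insert_of_mem hd)
    rw [Finset.prod_insert hc, mul_comm]
    refine mul_dvd_mul_left _ ?_
    have h0 := hg c (Finset.mem_insert_self _ _)
    rw [map_mul, map_prod, mul_eq_zero] at h0
    have h1 := h0.resolve_left (Finset.prod_ne_zero_iff.2 fun d hd => by
      rw [map_sub, rename_X, rename_X, sub_ne_zero]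
      intro he
      have he := X_injective he
      have hdc : d ≠ c := fun h => hc (h ▸ hd)
      by_cases hb : d.1 = c.1
      · rw [hb] at he
        simp only [Function.update_self, ne_eq, reduceCtorEq, not_false_eq_true,
          Function.update_of_ne, id_eq, Sum.inl.injEq] at he
        exact hdc (Prod.ext hb he)
      · simp [hb] at he)
    simpa [h1] using X_sub_X_dvd_sub_rename (Sum.inl c.2) (Sum.inr (Sum.inl c.1)) h

theorem rename_update_eq_zero_of_symmetric {g : MvPolynomial (α ⊕ β ⊕ κ) K}
    (hg : ∀ (π : Equiv.Perm α) (τ : Equiv.Perm β) (ρ : Equiv.Perm κ),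
      rename (Sum.map π (Sum.map τ ρ)) g = g) {i₀ : α} {l₀ : β}
    (h₀ : rename (Function.update id (Sum.inr (Sum.inl l₀)) (Sum.inl i₀)) g = 0) (i : α) (l : β) :
    rename (Function.update id (Sum.inr (Sum.inl l)) (Sum.inl i)) g = 0 := by
  have h := hg (Equiv.swap i₀ i) (Equiv.swap l₀ l) 1
  rw [← h, rename_rename]
  have h1 : Function.update id (Sum.inr (Sum.inl l)) (Sum.inl i) ∘
      Sum.map (Equiv.swap i₀ i) (Sum.map (Equiv.swap l₀ l) (1 : Equiv.Perm κ)) =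
      Sum.map (Equiv.swap i₀ i) (Sum.map (Equiv.swap l₀ l) (1 : Equiv.Perm κ)) ∘
        Function.update id (Sum.inr (Sum.inl l₀)) (Sum.inl i₀) := by
    funext v
    rcases v with v | v | v
    · simp
    · by_cases hv : v = l₀
      · simp [hv]
      · have hv' : Equiv.swap l₀ l v ≠ l := fun h =>
          hv ((Equiv.swap l₀ l).injective (h.trans (Equiv.swap_apply_left l₀ l).symm))
        simp [hv, hv']
    · simp
  rw [h1, ← rename_rename, h₀, map_zero]

theorem mem_map_adjoin_of_rename_eq_zero {p : ℕ} [Fact p.Prime] [CharP K p] {m n b : ℕ}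
    [Fintype α] [Fintype κ] (eX : Fin m ≃ α ⊕ κ) (eY : Fin n ≃ Fin b ⊕ κ)
    {g : MvPolynomial (α ⊕ Fin b ⊕ κ) K}
    (hg : ∀ (π : Equiv.Perm α) (τ : Equiv.Perm (Fin b)) (ρ : Equiv.Perm κ),
      rename (Sum.map π (Sum.map τ ρ)) g = g)
    (hd : ∀ t, pderiv (Sum.inr (Sum.inr t)) g = 0)
    (h₀ : ∀ i l, rename (Function.update id (Sum.inr (Sum.inl l)) (Sum.inl i)) g = 0) :
    g ∈ (Algebra.adjoin K (nsGens K p m n)).map (rename (glue eX eY)) := by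
  obtain ⟨h, hh⟩ := prod_sub_dvd_of_rename_eq_zero Finset.univ g fun c _ => h₀ c.2 c.1
  rw [Fintype.prod_prod_type'
    (fun (l : Fin b) (i : α) => (X (Sum.inl i) - X (Sum.inr (Sum.inl l)) :
      MvPolynomial (α ⊕ Fin b ⊕ κ) K))] at hh
  set D : MvPolynomial (α ⊕ Fin b ⊕ κ) K :=
    ∏ l : Fin b, ∏ i : α, (X (Sum.inl i) - X (Sum.inr (Sum.inl l))) with hD
  have hD0 : D ≠ 0 := Finset.prod_ne_zero_iff.2 fun l _ => Finset.prod_ne_zero_iff.2 fun i _ => by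
    rw [sub_ne_zero]
    exact fun h => by simpa using X_injective h
  have hDsymm : ∀ (π : Equiv.Perm α) (τ : Equiv.Perm (Fin b)) (ρ : Equiv.Perm κ),
      rename (Sum.map π (Sum.map τ ρ)) D = D := fun π τ ρ => by
    simp only [hD, map_prod, map_sub, rename_X, Sum.map_inl, Sum.map_inr]
    rw [Equiv.prod_comp τ fun l => ∏ i : α, (X (Sum.inl (π i)) - X (Sum.inr (Sum.inl l)))]
    exact Finset.prod_congr rfl fun l _ =>
      Equiv.prod_comp π fun i => X (Sum.inl i) - X (Sum.inr (Sum.inl l))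
  have hDd : ∀ t, pderiv (Sum.inr (Sum.inr t)) D = 0 := fun t => by
    have hmul : ∀ u v : MvPolynomial (α ⊕ Fin b ⊕ κ) K, pderiv (Sum.inr (Sum.inr t)) u = 0 →
        pderiv (Sum.inr (Sum.inr t)) v = 0 → pderiv (Sum.inr (Sum.inr t)) (u * v) = 0 :=
      fun u v hu hv => by simp [hu, hv]
    refine Finset.prod_induction _ (fun u => pderiv _ u = 0) hmul pderiv_one fun l _ =>
      Finset.prod_induction _ (fun u => pderiv _ u = 0) hmul pderiv_one fun i _ => ?_
    rw [map_sub, pderiv_X_of_ne (by simp), pderiv_X_of_ne (by simp), sub_zero]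
  have hhs : ∀ (π : Equiv.Perm α) (τ : Equiv.Perm (Fin b)) (ρ : Equiv.Perm κ),
      rename (Sum.map π (Sum.map τ ρ)) h = h := fun π τ ρ => by
    have h1 := hg π τ ρ
    rw [hh, map_mul, hDsymm] at h1
    exact mul_left_cancel₀ hD0 h1
  have hhd : ∀ t, pderiv (Sum.inr (Sum.inr t)) h = 0 := fun t => by
    have h1 := hd t
    rw [hh, Derivation.leibniz, hDd, smul_zero, add_zero, smul_eq_mul] at h1
    exact (mul_eq_zero.1 h1).resolve_left hD0
  rw [hh]
  exact prod_sub_mul_mem_map_adjoin eX eY (fun π => by simpa using hhs π 1 1)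
    (fun τ => by simpa using hhs 1 τ 1) (fun ρ => by simpa using hhs 1 1 ρ) hhd

end Vanishing

section Supersymmetric

theorem pderiv_rename_of_fiber {K σ τ : Type*} [CommRing K] {q : σ → τ} {v w : σ} {t : τ}
    (hvw : v ≠ w) (hq : ∀ u, q u = t ↔ u = v ∨ u = w) (f : MvPolynomial σ K) :
    pderiv t (rename q f) = rename q (pderiv v f + pderiv w f) := by
  classical
  induction f using MvPolynomial.induction_on with
  | C a => simp
  | add f g hf hg =>
    simp only [map_add, hf, hg]
    ring
  | mul_X f i hf =>
    have h : (pderiv t (X (q i)) : MvPolynomial τ K) =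
        rename q (pderiv v (X i) + pderiv w (X i)) := by
      by_cases h1 : i = v
      · subst h1
        rw [(hq i).2 (Or.inl rfl), pderiv_X_self, pderiv_X_self, pderiv_X_of_ne hvw]
        simp
      · by_cases h2 : i = w
        · subst h2
          rw [(hq i).2 (Or.inr rfl), pderiv_X_self, pderiv_X_self, pderiv_X_of_ne hvw.symm]
          simp
        · rw [pderiv_X_of_ne fun h => ((hq i).1 h).elim h1 h2, pderiv_X_of_ne h1,
            pderiv_X_of_ne h2]
          simp
    simp only [map_mul, rename_X, Derivation.leibniz, hf, h, smul_eq_mul, map_add]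
    ring

variable {K : Type*} [Field K] {m n : ℕ}

theorem psiSub_X_inl (i : Fin (m + 1)) : psiSub K (m + 1) (n + 1) (X (Sum.inl i)) =
    if i = Fin.last m then Polynomial.X else Polynomial.C (X (Sum.inl i)) := by
  simp [psiSub, Fin.ext_iff]

theorem psiSub_X_inr (j : Fin (n + 1)) : psiSub K (m + 1) (n + 1) (X (Sum.inr j)) =
    if j = Fin.last n then Polynomial.X else Polynomial.C (X (Sum.inr j)) := by
  simp [psiSub, Fin.ext_iff]

theorem derivative_psiSub (f : MvPolynomial (Fin (m + 1) ⊕ Fin (n + 1)) K) :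
    Polynomial.derivative (psiSub K (m + 1) (n + 1) f) = psiSub K (m + 1) (n + 1)
      (pderiv (Sum.inl (Fin.last m)) f + pderiv (Sum.inr (Fin.last n)) f) := by
  induction f using MvPolynomial.induction_on with
  | C a =>
    rw [← algebraMap_eq, AlgHom.commutes, IsScalarTower.algebraMap_apply K
      (MvPolynomial (Fin (m + 1) ⊕ Fin (n + 1)) K), Polynomial.algebraMap_eq,
      Polynomial.derivative_C]
    simp
  | add f g hf hg =>
    simp only [map_add, hf, hg]
    ring
  | mul_X f i hf =>
    have h : Polynomial.derivative (psiSub K (m + 1) (n + 1) (X i)) = psiSub K (m + 1) (n + 1)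
        (pderiv (Sum.inl (Fin.last m)) (X i) + pderiv (Sum.inr (Fin.last n)) (X i)) := by
      rcases i with i | i
      · rw [psiSub_X_inl, pderiv_X_of_ne (i := Sum.inr (Fin.last n)) (by simp)]
        split_ifs with hi
        · simp [hi]
        · rw [pderiv_X_of_ne (by simpa using hi)]
          simp
      · rw [psiSub_X_inr, pderiv_X_of_ne (i := Sum.inl (Fin.last m)) (by simp)]
        split_ifs with hi
        · simp [hi]
        · rw [pderiv_X_of_ne (by simpa using hi)]
          simp
    simp only [map_mul, Polynomial.derivative_mul, Derivation.leibniz, hf, h, smul_eq_mul, map_add]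
    ring

theorem aeval_psiSub (f : MvPolynomial (Fin (m + 1) ⊕ Fin (n + 1)) K) :
    Polynomial.aeval (X (Sum.inl (Fin.last m)) : MvPolynomial (Fin (m + 1) ⊕ Fin (n + 1)) K)
      (psiSub K (m + 1) (n + 1) f) =
      rename (Function.update id (Sum.inr (Fin.last n)) (Sum.inl (Fin.last m))) f := by
  induction f using MvPolynomial.induction_on with
  | C a =>
    rw [← algebraMap_eq, AlgHom.commutes, AlgHom.commutes, IsScalarTower.algebraMap_apply K
      (MvPolynomial (Fin (m + 1) ⊕ Fin (n + 1)) K), Polynomial.algebraMap_eq, Polynomial.aeval_C]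
    rfl
  | add f g hf hg => simp only [map_add, hf, hg]
  | mul_X f i hf =>
    rw [map_mul, map_mul, map_mul, hf, rename_X]
    congr 1
    rcases i with i | i
    · rw [psiSub_X_inl]
      split_ifs with hi <;> simp [hi]
    · rw [psiSub_X_inr]
      split_ifs with hi <;> simp [hi]

theorem IsSupersymmetric.rename_sumMap {f : MvPolynomial (Fin m ⊕ Fin n) K}
    (hf : IsSupersymmetric K m n f) (σ : Equiv.Perm (Fin m)) (τ : Equiv.Perm (Fin n)) :
    rename (Sum.map σ τ) f = f := by
  conv_rhs => rw [← hf.1 σ, ← hf.2.1 τ, rename_rename, Sum.map_comp_map]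
  rfl

/-- The sum of the partial derivatives of a supersymmetric polynomial with respect to `x i` and
`y j` vanishes after the identification `x i = y j`. -/
theorem IsSupersymmetric.rename_pderiv_add {f : MvPolynomial (Fin m ⊕ Fin n) K}
    (hf : IsSupersymmetric K m n f) (i : Fin m) (j : Fin n) :
    rename (Function.update id (Sum.inr j) (Sum.inl i))
      (pderiv (Sum.inl i) f + pderiv (Sum.inr j) f) = 0 := by
  obtain ⟨m, rfl⟩ : ∃ k, m = k + 1 := ⟨m - 1, by have := i.2; omega⟩
  obtain ⟨n, rfl⟩ : ∃ k, n = k + 1 := ⟨n - 1, by have := j.2; omega⟩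
  set e : Equiv.Perm (Fin (m + 1) ⊕ Fin (n + 1)) :=
    Equiv.sumCongr (Equiv.swap (Fin.last m) i) (Equiv.swap (Fin.last n) j) with he
  have hel : e (Sum.inl (Fin.last m)) = Sum.inl i := by simp [he]
  have her : e (Sum.inr (Fin.last n)) = Sum.inr j := by simp [he]
  have hef : rename e f = f := hf.rename_sumMap _ _
  have h0 : rename (Function.update id (Sum.inr (Fin.last n)) (Sum.inl (Fin.last m)))
      (pderiv (Sum.inl (Fin.last m)) f + pderiv (Sum.inr (Fin.last n)) f) = 0 := by
    rw [← aeval_psiSub, ← derivative_psiSub, hf.2.2, map_zero]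
  have h1 : Function.update id (Sum.inr j) (Sum.inl i) ∘ e =
      e ∘ Function.update id (Sum.inr (Fin.last n)) (Sum.inl (Fin.last m)) := by
    rw [← her, ← hel]
    funext v
    by_cases hv : v = Sum.inr (Fin.last n)
    · simp [hv]
    · simp [hv]
  have h2 : pderiv (Sum.inl i) f + pderiv (Sum.inr j) f =
      rename e (pderiv (Sum.inl (Fin.last m)) f + pderiv (Sum.inr (Fin.last n)) f) := by
    rw [map_add, ← pderiv_rename e.injective, ← pderiv_rename e.injective, hef, hel, her]
  rw [h2, rename_rename, h1, ← rename_rename, h0, map_zero]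

variable (K m n) in
/-- The algebra `A_s(m|n)` of supersymmetric polynomials. -/
def supersymmetricSubalgebra : Subalgebra K (MvPolynomial (Fin m ⊕ Fin n) K) where
  carrier := {f | IsSupersymmetric K m n f}
  mul_mem' := fun ⟨h1, h2, h3⟩ ⟨h1', h2', h3'⟩ =>
    ⟨fun σ => by rw [map_mul, h1, h1'], fun τ => by rw [map_mul, h2, h2'],
      by rw [map_mul, Polynomial.derivative_mul, h3, h3', zero_mul, mul_zero, add_zero]⟩
  add_mem' := fun ⟨h1, h2, h3⟩ ⟨h1', h2', h3'⟩ =>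
    ⟨fun σ => by rw [map_add, h1, h1'], fun τ => by rw [map_add, h2, h2'],
      by rw [map_add, map_add, h3, h3', add_zero]⟩
  algebraMap_mem' := fun a =>
    ⟨fun σ => AlgHom.commutes _ a, fun τ => AlgHom.commutes _ a, by
      rw [AlgHom.commutes, IsScalarTower.algebraMap_apply K (MvPolynomial (Fin m ⊕ Fin n) K),
        Polynomial.algebraMap_eq, Polynomial.derivative_C]⟩

theorem isSupersymmetric_cpoly (r : ℕ) :
    IsSupersymmetric K (m + 1) (n + 1) (cpoly K (m + 1) (n + 1) r) := by
  have hid := map_cpoly (AlgHom.id K (MvPolynomial (Fin (m + 1) ⊕ Fin (n + 1)) K)) r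
  refine ⟨fun σ => ?_, fun τ => ?_, ?_⟩
  · rw [map_cpoly]
    refine Eq.trans ?_ hid.symm
    simp only [rename_X, Sum.map_inl, Sum.map_inr, superSeries]
    rw [elemSeries_comp_equiv σ fun i => X (Sum.inl i)]
    rfl
  · rw [map_cpoly]
    refine Eq.trans ?_ hid.symm
    simp only [rename_X, Sum.map_inl, Sum.map_inr, superSeries]
    rw [homSeries_comp_equiv τ fun j => -X (Sum.inr j)]
    rfl
  · have h : superSeries (fun i => psiSub K (m + 1) (n + 1) (X (Sum.inl i)))
        (fun j => psiSub K (m + 1) (n + 1) (X (Sum.inr j))) =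
        PowerSeries.map Polynomial.C (superSeries (fun i : Fin m => X (Sum.inl i.castSucc))
          fun j : Fin n => X (Sum.inr j.castSucc)) := by
      rw [superSeries, ← elemSeries_comp_equiv (finSumFinEquiv (m := m) (n := 1)),
        ← homSeries_comp_equiv (finSumFinEquiv (m := n) (n := 1))]
      refine (superSeries_cancel _ _ fun t => ?_).trans ?_
      · simp [psiSub_X_inl, psiSub_X_inr, Fin.ext_iff]
      · rw [map_superSeries]
        congr 1
        · funext i
          exact (psiSub_X_inl _).trans (if_neg (Fin.castSucc_ne_last i))
        · funext j
          exact (psiSub_X_inr _).trans (if_neg (Fin.castSucc_ne_last j))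
    rw [map_cpoly, h, PowerSeries.coeff_map, Polynomial.derivative_C]

theorem rename_map_sigmaX {r : ℕ} (σ : Equiv.Perm (Fin m)) (τ : Equiv.Perm (Fin n)) :
    rename (Sum.map σ τ) (sigmaX K m n r) = sigmaX K m n r := by
  conv_rhs => rw [sigmaX, ← esymm_isSymmetric (Fin m) K r σ, rename_rename]
  rw [sigmaX, rename_rename]
  rfl

theorem rename_map_sigmaY {r : ℕ} (σ : Equiv.Perm (Fin m)) (τ : Equiv.Perm (Fin n)) :
    rename (Sum.map σ τ) (sigmaY K m n r) = sigmaY K m n r := by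
  conv_rhs => rw [sigmaY, ← esymm_isSymmetric (Fin n) K r τ, rename_rename]
  rw [sigmaY, rename_rename]
  rfl

theorem esymm_card_eq_prod (σ : Type*) [Fintype σ] :
    esymm σ K (Fintype.card σ) = ∏ i, X i := by
  rw [esymm, ← Finset.card_univ, Finset.powersetCard_self, Finset.sum_singleton]

theorem exists_psiSub_sigmaX :
    ∃ a, psiSub K (m + 1) (n + 1) (sigmaX K (m + 1) (n + 1) (m + 1)) =
      Polynomial.C a * Polynomial.X := by
  refine ⟨∏ i : Fin m, X (Sum.inl i.castSucc), ?_⟩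
  have h := esymm_card_eq_prod (K := K) (Fin (m + 1))
  rw [Fintype.card_fin] at h
  rw [sigmaX, h, map_prod, map_prod, Fin.prod_univ_castSucc, map_prod]
  simp [psiSub_X_inl]

theorem exists_psiSub_sigmaY :
    ∃ a, psiSub K (m + 1) (n + 1) (sigmaY K (m + 1) (n + 1) (n + 1)) =
      Polynomial.C a * Polynomial.X := by
  refine ⟨∏ i : Fin n, X (Sum.inr i.castSucc), ?_⟩
  have h := esymm_card_eq_prod (K := K) (Fin (n + 1))
  rw [Fintype.card_fin] at h
  rw [sigmaY, h, map_prod, map_prod, Fin.prod_univ_castSucc, map_prod]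
  simp [psiSub_X_inr]

theorem adjoin_nsGens_le {p : ℕ} [CharP K p] :
    Algebra.adjoin K (nsGens K p (m + 1) (n + 1)) ≤
      supersymmetricSubalgebra K (m + 1) (n + 1) := by
  have hp0 : ∀ f : Polynomial (MvPolynomial (Fin (m + 1) ⊕ Fin (n + 1)) K),
      Polynomial.derivative (f ^ p) = 0 := fun f => by
    rw [Polynomial.derivative_pow, CharP.cast_eq_zero]
    simp
  refine Algebra.adjoin_le ?_
  rintro f (((⟨r, rfl⟩ | ⟨i, -, -, rfl⟩) | ⟨j, -, -, rfl⟩) | ⟨k, -, hk, rfl⟩)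
  · exact isSupersymmetric_cpoly r
  · exact ⟨fun σ => by rw [map_pow]; exact congrArg (· ^ p) (rename_map_sigmaX σ 1),
      fun τ => by rw [map_pow]; exact congrArg (· ^ p) (rename_map_sigmaX 1 τ),
      by rw [map_pow, hp0]⟩
  · exact ⟨fun σ => by rw [map_pow]; exact congrArg (· ^ p) (rename_map_sigmaY σ 1),
      fun τ => by rw [map_pow]; exact congrArg (· ^ p) (rename_map_sigmaY 1 τ),
      by rw [map_pow, hp0]⟩
  · refine ⟨fun σ => ?_, fun τ => ?_, ?_⟩
    · rw [map_mul, map_pow, map_pow]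
      exact congrArg₂ (fun u v => u ^ k * v ^ (p - k)) (rename_map_sigmaX σ 1)
        (rename_map_sigmaY σ 1)
    · rw [map_mul, map_pow, map_pow]
      exact congrArg₂ (fun u v => u ^ k * v ^ (p - k)) (rename_map_sigmaX 1 τ)
        (rename_map_sigmaY 1 τ)
    · obtain ⟨a, ha⟩ := exists_psiSub_sigmaX (K := K) (m := m) (n := n)
      obtain ⟨c, hc⟩ := exists_psiSub_sigmaY (K := K) (m := m) (n := n)
      have h : (Polynomial.C a * Polynomial.X) ^ k * (Polynomial.C c * Polynomial.X) ^ (p - k) =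
          Polynomial.C (a ^ k * c ^ (p - k)) * Polynomial.X ^ p := by
        rw [mul_pow, mul_pow, mul_mul_mul_comm, ← pow_add, Nat.add_sub_cancel' hk.le, map_mul,
          map_pow, map_pow]
      rw [map_mul, map_pow, map_pow, ha, hc, h, Polynomial.derivative_C_mul, hp0, mul_zero]

end Supersymmetric

section Main

variable {K : Type*} [Field K] {m n : ℕ}

theorem IsSupersymmetric.rename_glue {α β κ : Type*} (eX : Fin m ≃ α ⊕ κ) (eY : Fin n ≃ β ⊕ κ)
    {f : MvPolynomial (Fin m ⊕ Fin n) K} (hf : IsSupersymmetric K m n f) (π : Equiv.Perm α)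
    (τ : Equiv.Perm β) (ρ : Equiv.Perm κ) :
    rename (Sum.map π (Sum.map τ ρ)) (rename (glue eX eY) f) = rename (glue eX eY) f := by
  conv_rhs => rw [← hf.rename_sumMap ((eX.trans (Equiv.sumCongr π ρ)).trans eX.symm)
    ((eY.trans (Equiv.sumCongr τ ρ)).trans eY.symm)]
  rw [rename_rename, rename_rename]
  congr 2
  funext v
  rcases v with v | v
  · rcases h : eX v with u | u <;> simp [glue, h]
  · rcases h : eY v with u | u <;> simp [glue, h]

theorem IsSupersymmetric.pderiv_rename_glue {α β κ : Type*} (eX : Fin m ≃ α ⊕ κ)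
    (eY : Fin n ≃ β ⊕ κ) {f : MvPolynomial (Fin m ⊕ Fin n) K} (hf : IsSupersymmetric K m n f)
    (t : κ) : pderiv (Sum.inr (Sum.inr t)) (rename (glue eX eY) f) = 0 := by
  rw [pderiv_rename_of_fiber (v := Sum.inl (eX.symm (Sum.inr t)))
    (w := Sum.inr (eY.symm (Sum.inr t))) Sum.inl_ne_inr fun u => ?_]
  · have h : glue eX eY = glue eX eY ∘ Function.update id (Sum.inr (eY.symm (Sum.inr t)))
        (Sum.inl (eX.symm (Sum.inr t))) := by
      funext v
      by_cases hv : v = Sum.inr (eY.symm (Sum.inr t))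
      · simp [hv, glue]
      · simp [hv]
    rw [h, ← rename_rename, hf.rename_pderiv_add, map_zero]
  · rcases u with u | u
    · rcases h : eX u with v | v <;> simp [glue, h, Equiv.eq_symm_apply]
    · simp [glue, Equiv.eq_symm_apply]

/-- The bijection that moves the last variable to the group indexed by `κ`. -/
def moveLast {a : ℕ} {κ : Type*} : Fin (a + 1) ⊕ κ ≃ Fin a ⊕ (Fin 1 ⊕ κ) :=
  (Equiv.sumCongr finSumFinEquiv.symm (Equiv.refl κ)).trans (Equiv.sumAssoc _ _ _)

theorem exists_factor_update_comp_glue {a b : ℕ} {κ : Type*} [DecidableEq κ]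
    (eX : Fin m ≃ Fin (a + 1) ⊕ κ) (eY : Fin n ≃ Fin (b + 1) ⊕ κ) :
    ∃ w, Function.update id (Sum.inr (Sum.inl (Fin.last b))) (Sum.inl (Fin.last a)) ∘ glue eX eY =
      w ∘ glue (eX.trans moveLast) (eY.trans moveLast) := by
  refine ⟨Sum.elim (fun i => Sum.inl i.castSucc) (Sum.elim (fun j => Sum.inr (Sum.inl j.castSucc))
    (Sum.elim (fun _ => Sum.inl (Fin.last a)) fun t => Sum.inr (Sum.inr t))), ?_⟩
  funext v
  rcases v with v | v
  · rcases h : eX v with u | u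
    · induction u using Fin.lastCases with
      | last => simp [glue, moveLast, h]
      | cast u => simp [glue, moveLast, h]
    · simp [glue, moveLast, h]
  · rcases h : eY v with u | u
    · induction u using Fin.lastCases with
      | last => simp [glue, moveLast, h]
      | cast u => simp [glue, moveLast, h]
    · simp [glue, moveLast, h]

theorem exists_mem_adjoin_rename_glue_eq {p : ℕ} [Fact p.Prime] [CharP K p] (a : ℕ) :
    ∀ (b : ℕ) (κ : Type) [Fintype κ] [DecidableEq κ]
      (eX : Fin (m + 1) ≃ Fin a ⊕ κ) (eY : Fin (n + 1) ≃ Fin b ⊕ κ)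
      {f : MvPolynomial (Fin (m + 1) ⊕ Fin (n + 1)) K}, IsSupersymmetric K (m + 1) (n + 1) f →
      ∃ g ∈ Algebra.adjoin K (nsGens K p (m + 1) (n + 1)),
        rename (glue eX eY) g = rename (glue eX eY) f := by
  induction a with
  | zero =>
    intro b κ _ _ eX eY f hf
    exact mem_map_adjoin_of_rename_eq_zero eX eY (hf.rename_glue eX eY)
      (hf.pderiv_rename_glue eX eY) fun i => i.elim0
  | succ a ih =>
    intro b κ _ _ eX eY f hf
    rcases b with _ | b
    · exact mem_map_adjoin_of_rename_eq_zero eX eY (hf.rename_glue eX eY)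
        (hf.pderiv_rename_glue eX eY) fun _ l => l.elim0
    obtain ⟨g, hg, hgf⟩ := ih b (Fin 1 ⊕ κ) (eX.trans moveLast) (eY.trans moveLast) hf
    have hs : IsSupersymmetric K (m + 1) (n + 1) (f - g) :=
      (supersymmetricSubalgebra K (m + 1) (n + 1)).sub_mem hf (adjoin_nsGens_le hg)
    obtain ⟨w, hw⟩ := exists_factor_update_comp_glue eX eY
    have h0 : rename (Function.update id (Sum.inr (Sum.inl (Fin.last b))) (Sum.inl (Fin.last a)))
        (rename (glue eX eY) (f - g)) = 0 := by
      rw [rename_rename, hw, ← rename_rename, map_sub, hgf, sub_self, map_zero]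
    obtain ⟨g', hg', h⟩ := mem_map_adjoin_of_rename_eq_zero (p := p) eX eY (hs.rename_glue eX eY)
      (hs.pderiv_rename_glue eX eY)
      (rename_update_eq_zero_of_symmetric (hs.rename_glue eX eY) h0)
    refine ⟨g + g', add_mem hg hg', ?_⟩
    have h' : rename (glue eX eY) g' = rename (glue eX eY) (f - g) := h
    rw [map_add, h', map_sub, add_sub_cancel]

end Main

/-- **Theorem 2.** Over an algebraically closed field of characteristic `p > 2`, the algebra
`A_s(m|n)` of supersymmetric polynomials equals `A_ns(m|n)`, the subalgebra generated by
`c_r` (r ≥ 0), `σ_i(x)^p` (1 ≤ i ≤ m), `σ_j(y)^p` (1 ≤ j ≤ n) and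
`u_k = σ_m(x)^k σ_n(y)^{p-k}` (0 < k < p). -/
theorem As_eq_Ans (K : Type*) [Field K] [IsAlgClosed K]
    (p : ℕ) [CharP K p] (hp : 2 < p) (m n : ℕ) (hm : 1 ≤ m) (hn : 1 ≤ n) :
    {f : MvPolynomial (Fin m ⊕ Fin n) K | IsSupersymmetric K m n f} =
      (Algebra.adjoin K (nsGens K p m n) : Subalgebra K (MvPolynomial (Fin m ⊕ Fin n) K)) := by
  obtain ⟨m, rfl⟩ := Nat.exists_eq_add_of_le' hm
  obtain ⟨n, rfl⟩ := Nat.exists_eq_add_of_le' hn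
  have : Fact p.Prime := ⟨(CharP.char_is_prime_or_zero K p).resolve_right (by omega)⟩
  refine Set.Subset.antisymm (fun f hf => ?_) adjoin_nsGens_le
  obtain ⟨g, hg, h⟩ := exists_mem_adjoin_rename_glue_eq (p := p) (m + 1) (n + 1) (Fin 0)
    (Equiv.sumEmpty _ _).symm (Equiv.sumEmpty _ _).symm hf
  have hinj : Function.Injective (glue (Equiv.sumEmpty (Fin (m + 1)) (Fin 0)).symm
      (Equiv.sumEmpty (Fin (n + 1)) (Fin 0)).symm) := by
    rintro (u | u) (v | v) <;> simp [glue]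
  rw [← rename_injective _ hinj h]
  exact hg

end
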